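/- arXiv:1806.05393 — 2 statements merged into one kernel-verified Lean document; each statement's English description precedes it below -/
import Mathlib

section
/- Let n ≥ 1, ker = {β ∈ ℤ : |β| ≤ k}, and let v = (v_β)_{β∈ker} be arbitrary real numbers; define A_v ⋆ on n×n real matrices by [A_v ⋆ C]_{α,α'} = Σ_{β∈ker} v_β C_{α+β, α'+β}, indices mod n. Let {V_{α,α'}} be the canonical basis of the symmetric matrices (V_{α,α'} has entry 1 at (α,α') and (α',α), 0 elsewhere), let χ_c, χ_q, κ ∈ ℝ, and let J be the linear map on symmetric n×n matrices with J V_{α,α'} = χ_c V_{α,α'} for α ≠ α' and J V_{α,α} = χ_q V_{α,α} + κ Σ_{α'≠α} V_{α,α'}. Then for every symmetric n×n matrix U, A_v ⋆ (J U) = J (A_v ⋆ U). -/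
/-- The circular cross-correlation operator `[A_v ⋆ C]_{α,α'} = ∑_β v_β C_{α+β,α'+β}`. -/
noncomputable def aveOp (n k : ℕ) (v : ℤ → ℝ) (C : Matrix (ZMod n) (ZMod n) ℝ) :
    Matrix (ZMod n) (ZMod n) ℝ :=
  Matrix.of fun α α' =>
    ∑ β ∈ Finset.Icc (-(k : ℤ)) (k : ℤ), v β * C (α + (β : ZMod n)) (α' + (β : ZMod n))

/-- Canonical symmetric basis matrix `V_{α,α'}`, with entry 1 at `(α,α')` and `(α',α)`,
0 elsewhere. -/
noncomputable def Vb (n : ℕ) (α α' : ZMod n) : Matrix (ZMod n) (ZMod n) ℝ :=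
  Matrix.of fun a b =>
    if (a = α ∧ b = α') ∨ (a = α' ∧ b = α) then (1 : ℝ) else 0

theorem Vb_apply_aux (n : ℕ) (α α' a b : ZMod n) :
    Vb n α α' a b = if a = b then (if α = a then (if α' = a then (1 : ℝ) else 0) else 0)
      else (if α = a then (if α' = b then (1 : ℝ) else 0) else 0)
        + (if α = b then (if α' = a then (1 : ℝ) else 0) else 0) := by
  simp only [Vb, Matrix.of_apply]
  split_ifs <;> grind

theorem sum_aux (n : ℕ) [NeZero n] (α a b : ZMod n) :
    ∑ α' ∈ Finset.univ.filter (· ≠ α), Vb n α α' a b =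
      if a = b then 0 else (if α = a then (1 : ℝ) else 0) + (if α = b then (1 : ℝ) else 0) := by
  simp only [Vb_apply_aux]
  by_cases hab : a = b
  · subst hab
    simp only [if_true]
    apply Finset.sum_eq_zero
    intro x hx
    have := (Finset.mem_filter.mp hx).2
    grind
  · have hba : b ≠ a := fun e => hab e.symm
    simp only [hab, if_false]
    rw [Finset.sum_add_distrib]
    by_cases h1 : α = a
    · subst h1
      simp [hab, hba]
    · by_cases h2 : α = b
      · subst h2
        simp [hab, h1]
      · simp [h1, h2]

theorem decomp_aux (n : ℕ) [NeZero n] (U : Matrix (ZMod n) (ZMod n) ℝ) (hU : U.IsSymm) :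
    U = ∑ α, ∑ α', (if α = α' then U α α' else U α α' / 2) • Vb n α α' := by
  ext a b
  simp only [Matrix.sum_apply, Matrix.smul_apply, smul_eq_mul, Vb_apply_aux]
  by_cases h : a = b
  · subst h
    simp
  · have h' : b ≠ a := fun e => h e.symm
    have := hU.apply a b
    simp [h, h', mul_add, Finset.sum_add_distrib]
    linarith

theorem J_apply_aux (n : ℕ) [NeZero n] (χc χq κ : ℝ)
    (J : Matrix (ZMod n) (ZMod n) ℝ →ₗ[ℝ] Matrix (ZMod n) (ZMod n) ℝ)
    (hod : ∀ α α' : ZMod n, α ≠ α' → J (Vb n α α') = χc • Vb n α α')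
    (hdg : ∀ α : ZMod n,
      J (Vb n α α) =
        χq • Vb n α α + κ • ∑ α' ∈ Finset.univ.filter (· ≠ α), Vb n α α')
    (U : Matrix (ZMod n) (ZMod n) ℝ) (hU : U.IsSymm) (a b : ZMod n) :
    J U a b = if a = b then χq * U a a else χc * U a b + κ * (U a a + U b b) := by
  have key : ∀ α α' : ZMod n, J (Vb n α α') a b =
      if a = b then χq * (if α = a then (if α' = a then (1 : ℝ) else 0) else 0)
      else χc * ((if α = a then (if α' = b then (1 : ℝ) else 0) else 0)
        + (if α = b then (if α' = a then (1 : ℝ) else 0) else 0))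
        + κ * ((if α = a then (if α' = a then (1 : ℝ) else 0) else 0)
        + (if α = b then (if α' = b then (1 : ℝ) else 0) else 0)) := by
    intro α α'
    by_cases h : α = α'
    · subst h
      rw [hdg]
      rw [Matrix.add_apply, Matrix.smul_apply, Matrix.smul_apply, Matrix.sum_apply, sum_aux,
        Vb_apply_aux, smul_eq_mul, smul_eq_mul]
      split_ifs <;> simp_all
    · rw [hod _ _ h, Matrix.smul_apply, smul_eq_mul, Vb_apply_aux]
      split_ifs <;> simp_all
  conv_lhs => rw [decomp_aux n U hU]
  simp only [map_sum, map_smul, Matrix.sum_apply, Matrix.smul_apply, smul_eq_mul, key]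
  by_cases h : a = b
  · subst h
    simp
    ring
  · have h' : b ≠ a := fun e => h e.symm
    have := hU.apply a b
    simp [h, h', mul_add, Finset.sum_add_distrib]
    rw [this]
    ring

/-- Theorem S3 of the paper: the Jacobian `J` of the mean-field C-map at its fixed
point (acting as `J V_{α,α'} = χ_c V_{α,α'}` for `α ≠ α'` and
`J V_{α,α} = χ_q V_{α,α} + κ ∑_{α'≠α} V_{α,α'}`) commutes with every circular
cross-correlation operator `A_v ⋆` on symmetric matrices. -/
theorem stmt10
    (n k : ℕ) [NeZero n] (hn : 1 ≤ n) (v : ℤ → ℝ) (χc χq κ : ℝ)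
    (J : Matrix (ZMod n) (ZMod n) ℝ →ₗ[ℝ] Matrix (ZMod n) (ZMod n) ℝ)
    (hod : ∀ α α' : ZMod n, α ≠ α' → J (Vb n α α') = χc • Vb n α α')
    (hdg : ∀ α : ZMod n,
      J (Vb n α α) =
        χq • Vb n α α + κ • ∑ α' ∈ Finset.univ.filter (· ≠ α), Vb n α α') :
    ∀ U : Matrix (ZMod n) (ZMod n) ℝ, U.IsSymm →
      aveOp n k v (J U) = J (aveOp n k v U) := by
  intro U hU
  have hA : (aveOp n k v U).IsSymm := by
    ext a b
    simp only [Matrix.transpose_apply, aveOp, Matrix.of_apply]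
    refine Finset.sum_congr rfl fun β _ => ?_
    rw [hU.apply]
  ext a b
  rw [J_apply_aux n χc χq κ J hod hdg _ hA]
  simp only [aveOp, Matrix.of_apply, J_apply_aux n χc χq κ J hod hdg U hU, add_left_inj]
  split_ifs with h
  · subst h
    rw [Finset.mul_sum]
    exact Finset.sum_congr rfl fun β _ => by ring
  · rw [← Finset.sum_add_distrib, Finset.mul_sum, Finset.mul_sum, ← Finset.sum_add_distrib]
    exact Finset.sum_congr rfl fun β _ => by ring
end

section
/- Let n ≥ 2, ker = {β ∈ ℤ : |β| ≤ k}, and let v = (v_β)_{β∈ker} be real numbers. Define A_v ⋆ on n×n matrices by [A_v ⋆ C]_{α,α'} = Σ_{β∈ker} v_β C_{α+β, α'+β}, indices mod n. Let χ_c, χ_q, κ ∈ ℝ with χ_q ≠ χ_c, let J be the linear map on symmetric n×n matrices with J V_{α,α'} = χ_c V_{α,α'} (α ≠ α') and J V_{α,α} = χ_q V_{α,α} + κ Σ_{α'≠α} V_{α,α'} in the canonical basis, and set L = (A_v ⋆) ∘ J. Write any symmetric matrix U uniquely as U = U_d + U_od with U_d ∈ span{Ṽ_α} and U_od ∈ span{V_{α,α'}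 : α ≠ α'}, where Ṽ_α = V_{α,α} + (κ/(χ_q−χ_c)) Σ_{α'≠α} V_{α,α'}. Then for every integer m ≥ 1, L^m(U) = (A_v ⋆)^m ( χ_q^m U_d + χ_c^m U_od ), where (A_v ⋆)^m denotes m-fold application of A_v ⋆. -/
/-- The modified diagonal vectors `Ṽ_α = V_{α,α} + (κ/(χ_q − χ_c)) ∑_{α'≠α} V_{α,α'}`. -/
noncomputable def Vt (n : ℕ) [NeZero n] (χc χq κ : ℝ) (α : ZMod n) : Matrix (ZMod n) (ZMod n) ℝ :=
  Vb n α α + (κ / (χq - χc)) • ∑ α' ∈ Finset.univ.filter (· ≠ α), Vb n α α'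

/-- The averaging operator as a linear map. -/
noncomputable def aveLin (n k : ℕ) (v : ℤ → ℝ) :
    Matrix (ZMod n) (ZMod n) ℝ →ₗ[ℝ] Matrix (ZMod n) (ZMod n) ℝ where
  toFun := aveOp n k v
  map_add' X Y := by
    ext a b
    simp [aveOp, mul_add, Finset.sum_add_distrib]
  map_smul' c X := by
    ext a b
    simp only [aveOp, Matrix.of_apply, Matrix.smul_apply, smul_eq_mul, RingHom.id_apply,
      Finset.mul_sum]
    exact Finset.sum_congr rfl fun _ _ => by ring

theorem Vb_shift (n : ℕ) (α α' a b β : ZMod n) :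
    Vb n α α' (a + β) (b + β) = Vb n (α - β) (α' - β) a b := by
  simp [Vb, eq_sub_iff_add_eq]

theorem Vt_shift (n : ℕ) [NeZero n] (χc χq κ : ℝ) (α a b β : ZMod n) :
    Vt n χc χq κ α (a + β) (b + β) = Vt n χc χq κ (α - β) a b := by
  simp only [Vt, Matrix.add_apply, Matrix.smul_apply, Matrix.sum_apply, Vb_shift]
  congr 2
  refine Finset.sum_bij (fun x _ => x - β) ?_ ?_ ?_ ?_
  · intro x hx
    simpa using hx
  · intro x _ y _ h
    simpa using h
  · intro y hy
    refine ⟨y + β, ?_, by simp⟩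
    simp only [Finset.mem_filter, Finset.mem_univ, true_and, ne_eq] at hy ⊢
    intro h
    exact hy (by rw [← h]; simp)
  · intro x _
    rfl

theorem aveLin_Vb (n k : ℕ) (v : ℤ → ℝ) (α α' : ZMod n) :
    aveLin n k v (Vb n α α') =
      ∑ β ∈ Finset.Icc (-(k : ℤ)) (k : ℤ), v β • Vb n (α - (β : ZMod n)) (α' - (β : ZMod n)) := by
  ext a b
  simp [aveLin, aveOp, Matrix.sum_apply, Vb_shift]

theorem aveLin_Vt (n k : ℕ) [NeZero n] (v : ℤ → ℝ) (χc χq κ : ℝ) (α : ZMod n) :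
    aveLin n k v (Vt n χc χq κ α) =
      ∑ β ∈ Finset.Icc (-(k : ℤ)) (k : ℤ), v β • Vt n χc χq κ (α - (β : ZMod n)) := by
  ext a b
  simp [aveLin, aveOp, Matrix.sum_apply, Vt_shift]

/-- Solution of the linearized covariance dynamics of deep CNNs: with
`L = (A_v ⋆) ∘ J` and `U = U_d + U_od` the decomposition into the diagonal eigenspace
`span{Ṽ_α}` and the off-diagonal eigenspace `span{V_{α,α'} : α ≠ α'}`, one has
`L^m(U) = (A_v ⋆)^m (χ_q^m U_d + χ_c^m U_od)` for every `m ≥ 1`. -/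
theorem stmt11
    (n k : ℕ) [NeZero n] (hn : 2 ≤ n) (v : ℤ → ℝ) (χc χq κ : ℝ) (hne : χq ≠ χc)
    (J : Matrix (ZMod n) (ZMod n) ℝ →ₗ[ℝ] Matrix (ZMod n) (ZMod n) ℝ)
    (hod : ∀ α α' : ZMod n, α ≠ α' → J (Vb n α α') = χc • Vb n α α')
    (hdg : ∀ α : ZMod n,
      J (Vb n α α) =
        χq • Vb n α α + κ • ∑ α' ∈ Finset.univ.filter (· ≠ α), Vb n α α')
    (U Ud Uod : Matrix (ZMod n) (ZMod n) ℝ)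
    (hsym : U.IsSymm)
    (hUd : Ud ∈ Submodule.span ℝ (Set.range (Vt n χc χq κ)))
    (hUod : Uod ∈ Submodule.span ℝ
      {M : Matrix (ZMod n) (ZMod n) ℝ | ∃ α α' : ZMod n, α ≠ α' ∧ M = Vb n α α'})
    (hU : U = Ud + Uod) :
    ∀ m : ℕ, 1 ≤ m →
      (fun X => aveOp n k v (J X))^[m] U =
        (aveOp n k v)^[m] (χq ^ m • Ud + χc ^ m • Uod) := by
  have hJd : ∀ X ∈ Submodule.span ℝ (Set.range (Vt n χc χq κ)), J X = χq • X := by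
    intro X hX
    induction hX using Submodule.span_induction with
    | mem x hx =>
      obtain ⟨α, rfl⟩ := hx
      have hs : J (∑ α' ∈ Finset.univ.filter (· ≠ α), Vb n α α') =
          χc • ∑ α' ∈ Finset.univ.filter (· ≠ α), Vb n α α' := by
        rw [map_sum, Finset.smul_sum]
        refine Finset.sum_congr rfl fun x hx => hod _ _ ?_
        exact (Finset.mem_filter.1 hx).2.symm
      have h0 : χq - χc ≠ 0 := sub_ne_zero.2 hne
      simp only [Vt]
      rw [map_add, map_smul, hs, hdg, smul_add, add_assoc, smul_smul, smul_smul, ← add_smul]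
      congr 2
      field_simp
      ring
    | zero => simp
    | add x y _ _ hx hy => rw [map_add, hx, hy, smul_add]
    | smul c x _ hx => rw [map_smul, hx, smul_comm]
  have hJo : ∀ X ∈ Submodule.span ℝ
      {M : Matrix (ZMod n) (ZMod n) ℝ | ∃ α α' : ZMod n, α ≠ α' ∧ M = Vb n α α'},
      J X = χc • X := by
    intro X hX
    induction hX using Submodule.span_induction with
    | mem x hx =>
      obtain ⟨α, α', h, rfl⟩ := hx
      exact hod _ _ h
    | zero => simp
    | add x y _ _ hx hy => rw [map_add, hx, hy, smul_add]
    | smul c x _ hx => rw [map_smul, hx, smul_comm]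
  have hAd : ∀ X ∈ Submodule.span ℝ (Set.range (Vt n χc χq κ)),
      aveLin n k v X ∈ Submodule.span ℝ (Set.range (Vt n χc χq κ)) := by
    intro X hX
    rw [← Submodule.mem_comap]
    refine Submodule.span_le.2 ?_ hX
    rintro _ ⟨α, rfl⟩
    simp only [Submodule.comap_coe, Set.mem_preimage, SetLike.mem_coe]
    rw [aveLin_Vt]
    exact Submodule.sum_mem _ fun β _ =>
      Submodule.smul_mem _ _ (Submodule.subset_span ⟨_, rfl⟩)
  have hAo : ∀ X ∈ Submodule.span ℝ
      {M : Matrix (ZMod n) (ZMod n) ℝ | ∃ α α' : ZMod n, α ≠ α' ∧ M = Vb n α α'},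
      aveLin n k v X ∈ Submodule.span ℝ
      {M : Matrix (ZMod n) (ZMod n) ℝ | ∃ α α' : ZMod n, α ≠ α' ∧ M = Vb n α α'} := by
    intro X hX
    rw [← Submodule.mem_comap]
    refine Submodule.span_le.2 ?_ hX
    rintro _ ⟨α, α', h, rfl⟩
    simp only [Submodule.comap_coe, Set.mem_preimage, SetLike.mem_coe]
    rw [aveLin_Vb]
    exact Submodule.sum_mem _ fun β _ =>
      Submodule.smul_mem _ _ (Submodule.subset_span ⟨_, _, by simpa using h, rfl⟩)
  intro m _
  subst hU
  clear hsym
  have hlin : aveOp n k v = aveLin n k v := rfl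
  rw [hlin]
  induction m generalizing Ud Uod with
  | zero => simp
  | succ m ih =>
    rw [Function.iterate_succ_apply, Function.iterate_succ_apply, map_add, hJd _ hUd, hJo _ hUod,
      map_add]
    rcases Nat.eq_zero_or_pos m with rfl | hm
    · simp
    rw [ih _ _ (hAd _ (Submodule.smul_mem _ _ hUd)) (hAo _ (Submodule.smul_mem _ _ hUod)) hm]
    congr 1
    simp only [map_add, map_smul, smul_smul, pow_succ]
end
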